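/- Let b ≥ 0 and p > 2 be real numbers, and let V : ℝ² → ℝ be continuously differentiable such that there exist constants 0 < V₀ ≤ V_∞ with V₀ ≤ V(x) ≤ V_∞ for all x ∈ ℝ², and there exists η > 0 with |⟨∇V(x), x⟩| ≤ η for all x ∈ ℝ². Let d ∈ ℝ and let (u_n) be a sequence of continuously differentiable functions ℝ² → ℝ such that for every n the functions x ↦ ‖∇u_n(x)‖², x ↦ u_n(x)² and x ↦ |u_n(x)|^p are integrable on ℝ² and (x,y) ↦ |log(‖x−y‖)|·u_n(x)²u_n(y)² is integrable on ℝ²×ℝ². If I(u_n) → d and J(u_n) → 0 as n → ∞, then the sequence (u_n) is bounded in H¹(ℝ²), i.e. there exists C > 0 such that ∫_{ℝ²}(‖∇u_n(x)‖² + u_n(x)²) dx ≤ C for all n. -/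

import Mathlib

open MeasureTheory Filter
open scoped InnerProductSpace

abbrev E2 := EuclideanSpace ℝ (Fin 2)

/-- The energy functional `I` of the planar Schrödinger–Poisson problem. -/
noncomputable def energyI (b p : ℝ) (V u : E2 → ℝ) : ℝ :=
  (1 / 2) * (∫ x : E2, (‖gradient u x‖ ^ 2 + V x * (u x) ^ 2)) +
    (1 / (8 * Real.pi)) *
      (∫ z : E2 × E2, Real.log ‖z.1 - z.2‖ * (u z.1) ^ 2 * (u z.2) ^ 2) -
    (b / p) * (∫ x : E2, |u x| ^ p)

/-- The auxiliary (Nehari–Pohozaev) functional `J`. -/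
noncomputable def energyJ (b p : ℝ) (V u : E2 → ℝ) : ℝ :=
  (∫ x : E2, (2 * ‖gradient u x‖ ^ 2 +
      (V x - (1 / 2) * ⟪gradient V x, x⟫_ℝ) * (u x) ^ 2 -
      (2 * b * (p - 1) / p) * |u x| ^ p)) -
    (1 / (8 * Real.pi)) * (∫ x : E2, (u x) ^ 2) ^ 2 +
    (1 / (2 * Real.pi)) *
      (∫ z : E2 × E2, Real.log ‖z.1 - z.2‖ * (u z.1) ^ 2 * (u z.2) ^ 2)

lemma young_abs (B s t : ℝ) (hB : 0 < B) : s * t ≤ B * s ^ 2 + t ^ 2 / B := by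
  have h : 0 ≤ (B * s - t / 2) ^ 2 / B := by positivity
  have e : (B * s - t / 2) ^ 2 / B = B * s ^ 2 - s * t + t ^ 2 / B / 4 := by field_simp; ring
  have : 0 ≤ t ^ 2 / B := by positivity
  linarith

lemma self_bound (c σ : ℝ) (hσ : σ < 1) : ∃ D : ℝ, 1 ≤ D ∧ ∀ B : ℝ, 1 ≤ B → B ≤ c * B ^ σ → B ≤ D := by
  refine ⟨max 1 ((max c 0) ^ (1 / (1 - σ))), le_max_left _ _, fun B hB h => le_max_of_le_right ?_⟩
  have hB0 : 0 < B := by linarith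
  have h1 : B ^ (1 - σ) ≤ max c 0 := by
    rw [Real.rpow_sub hB0, Real.rpow_one, div_le_iff₀ (by positivity)]
    exact h.trans (by gcongr; exact le_max_left _ _)
  have h2 := Real.rpow_le_rpow (by positivity) h1 (z := 1 / (1 - σ)) (by
    apply div_nonneg <;> linarith)
  rwa [← Real.rpow_mul hB0.le, mul_one_div_cancel (by linarith), Real.rpow_one] at h2

lemma quad_bound (a M T : ℝ) (ha : 0 ≤ a) (hT : 1 ≤ T) (hM : 0 ≤ M) (h : M ^ 2 ≤ a + a * M * T) :
    M ≤ (a + 1) * T := by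
  by_contra! hc
  have : a + 1 ≤ (a+1)*T := by nlinarith
  nlinarith [mul_lt_mul_of_pos_left hc (show 0 < M by linarith)]

set_option maxHeartbeats 1000000 in
/-- The purely numerical end of the argument. -/
lemma numeric (b p K η C₁ C₂ C₃ : ℝ) (hb : 0 ≤ b) (hp : 2 < p) (hK : 0 ≤ K) (hη : 0 < η)
    (hC₁ : 0 ≤ C₁) (hC₂ : 0 ≤ C₂) (hC₃ : 0 ≤ C₃) :
    ∃ D : ℝ, 0 < D ∧ ∀ A M P L v W I J : ℝ, 0 ≤ A → 0 ≤ M → 0 ≤ P → 0 ≤ v → |W| ≤ η * M →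
      I ≤ K → -K ≤ J →
      I = (1 / 2) * (A + v) + (1 / (8 * Real.pi)) * L - (b / p) * P →
      J = 2 * A + v - (1 / 2) * W - (2 * b * (p - 1) / p) * P - (1 / (8 * Real.pi)) * M ^ 2
        + (1 / (2 * Real.pi)) * L →
      -L ≤ (1 / 2) * Real.log (A + 1) * M ^ 2 + M * (C₁ + C₂ * M) →
      (p ≤ 3 → P ≤ C₃ * M * (A + 1) ^ ((p - 2) / 2)) → A + M ≤ D := by
  have hπ := Real.pi_pos
  obtain ⟨s, a, hs0, hs, ha, key⟩ : ∃ s a : ℝ, 0 < s ∧ s < 1 / 2 ∧ 0 ≤ a ∧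
      ∀ A M P v W : ℝ, 0 ≤ A → 0 ≤ M → 0 ≤ P → 0 ≤ v → |W| ≤ η * M →
      v + W / 2 + (2 * b * (p - 3) / p) * P + (1 / (8 * Real.pi)) * M ^ 2 ≤ 5 * K →
      (p ≤ 3 → P ≤ C₃ * M * (A + 1) ^ ((p - 2) / 2)) →
      M ≤ a * (A + 1) ^ s ∧ b * P ≤ a * (A + 1) ^ (2 * s) := by
    rcases lt_or_ge p 3 with h3 | h3
    · set a₀ := 8 * Real.pi * (5 * K + η / 2 + (2 * b * (3 - p) / p) * C₃) with ha₀
      have hc : 0 ≤ 2 * b * (3 - p) / p := by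
        apply div_nonneg (mul_nonneg _ _) <;> linarith
      have ha₀0 : 0 ≤ a₀ := by positivity
      refine ⟨(p - 2) / 2, (a₀ + 1) + b * C₃ * (a₀ + 1), by linarith, by linarith, by positivity, ?_⟩
      intro A M P v W hA hM hP hv hW h h'
      have hP' := h' h3.le
      set T := (A + 1) ^ ((p - 2) / 2) with hT
      have hT1 : 1 ≤ T := Real.one_le_rpow (by linarith) (by linarith)
      have hTT : (A + 1) ^ (2 * ((p - 2) / 2)) = T * T := by
        rw [hT, ← Real.rpow_add (by linarith)]; ring_nf
      have hM' : M ≤ (a₀ + 1) * T := by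
        apply quad_bound a₀ M T ha₀0 hT1 hM
        have e1 : (2 * b * (p - 3) / p) * P = - ((2 * b * (3 - p) / p) * P) := by ring
        have e2 := mul_le_mul_of_nonneg_left hP' hc
        have e3 : (1 / (8 * Real.pi)) * M ^ 2 ≤
            5 * K + η / 2 * M + (2 * b * (3 - p) / p) * (C₃ * M * T) := by
          have := (abs_le.1 hW).1
          linarith
        have e4 : M ^ 2 ≤ 8 * Real.pi * (5 * K + η / 2 * M + (2 * b * (3 - p) / p) * (C₃ * M * T)) := by
          rw [one_div, inv_mul_le_iff₀ (by positivity)] at e3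
          exact e3
        refine e4.trans ?_
        have e5 : a₀ + a₀ * M * T = 8 * Real.pi * ((5 * K + 5 * K * (M * T)) + (η / 2 + η / 2 * (M * T))
          + ((2 * b * (3 - p) / p) * C₃ + (2 * b * (3 - p) / p) * (C₃ * M * T))) := by
          rw [ha₀]; ring
        rw [e5]
        have e6 : M ≤ M * T := by nlinarith
        have : 0 ≤ K * (M * T) := by positivity
        have : 0 ≤ (2 * b * (3 - p) / p) * C₃ := by positivity
        have : η / 2 * M ≤ η / 2 * (M * T) := by gcongr
        gcongr <;> linarith
      constructor
      · refine hM'.trans (mul_le_mul_of_nonneg_right ?_ (by linarith))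
        have : 0 ≤ b * C₃ * (a₀ + 1) := by positivity
        linarith
      · rw [hTT]
        calc b * P ≤ b * (C₃ * M * T) := by gcongr
          _ ≤ b * (C₃ * ((a₀ + 1) * T) * T) := by gcongr
          _ = (b * C₃ * (a₀ + 1)) * (T * T) := by ring
          _ ≤ _ := by gcongr; linarith
    · set a₀ := 8 * Real.pi * (5 * K + η / 2) with ha₀
      have ha₀0 : 0 ≤ a₀ := by positivity
      set Q := 5 * K + η / 2 * (a₀ + 1) with hQ
      have hQ0 : 0 ≤ Q := by positivity
      have hM' : ∀ M P v W : ℝ, 0 ≤ M → 0 ≤ P → 0 ≤ v → |W| ≤ η * M →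
          v + W / 2 + (2 * b * (p - 3) / p) * P + (1 / (8 * Real.pi)) * M ^ 2 ≤ 5 * K →
          M ≤ a₀ + 1 ∧ (2 * b * (p - 3) / p) * P ≤ Q := by
        intro M P v W hM hP hv hW h
        have hc : 0 ≤ (2 * b * (p - 3) / p) * P := by
          apply mul_nonneg (div_nonneg (mul_nonneg _ _) _) <;> linarith
        have hW1 := (abs_le.1 hW).1
        have hm : M ≤ a₀ + 1 := by
          have := quad_bound a₀ M 1 ha₀0 le_rfl hM ?_
          · linarith
          have e3 : (1 / (8 * Real.pi)) * M ^ 2 ≤ 5 * K + η / 2 * M := by linarith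
          rw [one_div, inv_mul_le_iff₀ (by positivity)] at e3
          refine e3.trans ?_
          have e5 : a₀ + a₀ * M * 1 = 8 * Real.pi * ((5 * K + 5 * K * M) + (η / 2 + η / 2 * M)) := by
            rw [ha₀]; ring
          rw [e5]
          have : 0 ≤ K * M := by positivity
          gcongr <;> linarith
        refine ⟨hm, ?_⟩
        have : 0 ≤ (1 / (8 * Real.pi)) * M ^ 2 := by positivity
        have : η / 2 * M ≤ η / 2 * (a₀ + 1) := by gcongr
        linarith
      rcases h3.eq_or_lt with h3 | h3
      · subst h3
        refine ⟨1 / 4, (a₀ + 1) + b * C₃ * (a₀ + 1), by norm_num, by norm_num, by positivity, ?_⟩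
        intro A M P v W hA hM hP hv hW h h'
        have hP' := h' le_rfl
        have hm := (hM' M P v W hM hP hv hW h).1
        have h1 : 1 ≤ (A + 1) ^ (1 / 4 : ℝ) := Real.one_le_rpow (by linarith) (by norm_num)
        have hz : 0 ≤ b * C₃ * (a₀ + 1) := by positivity
        constructor
        · nlinarith
        · have e : (2 * (1 / 4 : ℝ)) = (3 - 2) / 2 := by norm_num
          rw [e]
          calc b * P ≤ b * (C₃ * M * (A + 1) ^ ((3 - 2 : ℝ) / 2)) := by gcongr
            _ ≤ b * (C₃ * (a₀ + 1) * (A + 1) ^ ((3 - 2 : ℝ) / 2)) := by gcongr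
            _ = (b * C₃ * (a₀ + 1)) * (A + 1) ^ ((3 - 2 : ℝ) / 2) := by ring
            _ ≤ _ := by gcongr; linarith
      · have hp3 : 0 < p - 3 := by linarith
        have hp0 : 0 < p := by linarith
        refine ⟨1 / 4, (a₀ + 1) + Q * (p / (2 * (p - 3))), by norm_num, by norm_num, by positivity, ?_⟩
        intro A M P v W hA hM hP hv hW h h'
        obtain ⟨hm, hq⟩ := hM' M P v W hM hP hv hW h
        have h1 : 1 ≤ (A + 1) ^ (1 / 4 : ℝ) := Real.one_le_rpow (by linarith) (by norm_num)
        have h2 : 1 ≤ (A + 1) ^ (2 * (1 / 4) : ℝ) := Real.one_le_rpow (by linarith) (by norm_num)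
        have hz : 0 ≤ Q * (p / (2 * (p - 3))) := by positivity
        constructor
        · nlinarith
        · have e : b * P = (2 * b * (p - 3) / p) * P * (p / (2 * (p - 3))) := by field_simp
          have : b * P ≤ Q * (p / (2 * (p - 3))) := by rw [e]; gcongr
          nlinarith
  set ε := (1 - 2 * s) / 2 with hε
  have hε0 : 0 < ε := by rw [hε]; linarith
  set σ := 2 * s + ε with hσ
  have hp0 : 0 < p := by linarith
  obtain ⟨D, hD, hDB⟩ := self_bound (1 + 2 * (K + (1 / (8 * Real.pi)) *
    ((1 / 2) * (1 / ε) * a ^ 2 + a * (C₁ + C₂ * a)) + (1 / p) * a)) σ (by rw [hσ, hε]; linarith)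
  refine ⟨D + a * D ^ s, by positivity, ?_⟩
  intro A M P L v W I J hA hM hP hv hW hI hJ eI eJ hL hP3
  have hid : v + W / 2 + (2 * b * (p - 3) / p) * P + (1 / (8 * Real.pi)) * M ^ 2 = 4 * I - J := by
    rw [eI, eJ]; field_simp; ring
  obtain ⟨hm, hbp⟩ := key A M P v W hA hM hP hv hW (by rw [hid]; linarith) hP3
  set B := A + 1 with hB
  have hB1 : 1 ≤ B := by linarith
  have hB0 : 0 < B := by linarith
  have hBs : B ^ (2 * s) = B ^ s * B ^ s := by rw [← Real.rpow_add hB0]; ring_nf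
  have hsσ : B ^ (2 * s) ≤ B ^ σ := Real.rpow_le_rpow_of_exponent_le hB1 (by linarith)
  have hsσ' : B ^ s ≤ B ^ σ := Real.rpow_le_rpow_of_exponent_le hB1 (by linarith)
  have h1σ : 1 ≤ B ^ σ := Real.one_le_rpow hB1 (by linarith)
  have hM2 : M ^ 2 ≤ a ^ 2 * B ^ (2 * s) := by
    calc M ^ 2 ≤ (a * B ^ s) ^ 2 := by gcongr
      _ = _ := by rw [hBs]; ring
  have hlog : Real.log B ≤ B ^ ε / ε := Real.log_le_rpow_div hB0.le hε0
  have hlog0 : 0 ≤ Real.log B := Real.log_nonneg hB1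
  have t1 : (1 / 2) * Real.log B * M ^ 2 ≤ (1 / 2) * (1 / ε) * a ^ 2 * B ^ σ := by
    calc (1 / 2) * Real.log B * M ^ 2 ≤ (1 / 2) * (B ^ ε / ε) * (a ^ 2 * B ^ (2 * s)) := by gcongr
      _ = _ := by rw [hσ, Real.rpow_add hB0]; ring
  have t2 : M * (C₁ + C₂ * M) ≤ a * (C₁ + C₂ * a) * B ^ σ := by
    calc M * (C₁ + C₂ * M) = C₁ * M + C₂ * M ^ 2 := by ring
      _ ≤ C₁ * (a * B ^ σ) + C₂ * (a ^ 2 * B ^ σ) := by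
        gcongr
        · exact hm.trans (by gcongr)
        · exact hM2.trans (by gcongr)
      _ = _ := by ring
  have t3 : (b / p) * P ≤ (1 / p) * a * B ^ σ := by
    calc (b / p) * P = (1 / p) * (b * P) := by ring
      _ ≤ (1 / p) * (a * B ^ σ) := mul_le_mul_of_nonneg_left
          (hbp.trans (mul_le_mul_of_nonneg_left hsσ ha)) (by positivity)
      _ = _ := by ring
  have t4 : (1 / (8 * Real.pi)) * (-L) ≤ (1 / (8 * Real.pi)) *
    ((1 / 2) * (1 / ε) * a ^ 2 + a * (C₁ + C₂ * a)) * B ^ σ := by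
    rw [mul_assoc]
    refine mul_le_mul_of_nonneg_left ?_ (by positivity)
    linarith
  have hKσ : K ≤ K * B ^ σ := le_mul_of_one_le_right hK h1σ
  have hBD : B ≤ D := by
    apply hDB B hB1
    linarith
  have : a * B ^ s ≤ a * D ^ s := by gcongr
  linarith

lemma norm_grad (u : E2 → ℝ) (x : E2) : ‖gradient u x‖ = ‖fderiv ℝ u x‖ := by
  rw [gradient, LinearIsometryEquiv.norm_map]

/-- Cauchy–Schwarz for `|u| ‖∇u‖`. -/
lemma cs_grad (u : E2 → ℝ) (hu : ContDiff ℝ 1 u)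
    (h1 : Integrable (fun x : E2 => ‖fderiv ℝ u x‖ ^ 2)) (h2 : Integrable (fun x : E2 => (u x) ^ 2)) :
    Integrable (fun x : E2 => |u x| * ‖fderiv ℝ u x‖) ∧
    (∫ x : E2, |u x| * ‖fderiv ℝ u x‖) ^ 2 ≤ (∫ x : E2, (u x) ^ 2) * ∫ x : E2, ‖fderiv ℝ u x‖ ^ 2 := by
  have hc : Continuous u := hu.continuous
  have hd : Continuous (fderiv ℝ u) := hu.continuous_fderiv (by norm_num)
  have m1 : MemLp (fun x => |u x|) 2 (volume : Measure E2) := by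
    rw [memLp_two_iff_integrable_sq (by fun_prop)]
    simpa using h2
  have m2 : MemLp (fun x => ‖fderiv ℝ u x‖) 2 (volume : Measure E2) := by
    rw [memLp_two_iff_integrable_sq (by fun_prop)]
    exact h1
  refine ⟨m1.integrable_mul m2, ?_⟩
  have := integral_mul_le_Lp_mul_Lq_of_nonneg (μ := (volume : Measure E2)) (p := 2) (q := 2)
    (Real.HolderConjugate.two_two) (f := fun x => |u x|) (g := fun x => ‖fderiv ℝ u x‖)
    (Eventually.of_forall fun x => abs_nonneg _) (Eventually.of_forall fun x => norm_nonneg _)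
    (by simpa using m1) (by simpa using m2)
  have p0 : 0 ≤ ∫ x : E2, |u x| * ‖fderiv ℝ u x‖ := integral_nonneg fun x => by positivity
  have p1 : 0 ≤ ∫ x : E2, (u x) ^ 2 := integral_nonneg fun x => by positivity
  have p2 : 0 ≤ ∫ x : E2, ‖fderiv ℝ u x‖ ^ 2 := integral_nonneg fun x => by positivity
  simp only [Real.rpow_two, sq_abs, ← Real.sqrt_eq_rpow] at this
  calc _ ≤ (√(∫ x : E2, (u x) ^ 2) * √(∫ x : E2, ‖fderiv ℝ u x‖ ^ 2)) ^ 2 := by gcongr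
    _ = _ := by rw [mul_pow, Real.sq_sqrt p1, Real.sq_sqrt p2]

/-- A family of cutoffs. -/
lemma cutoff : ∃ c : ℝ, 0 ≤ c ∧ ∀ R : ℝ, 0 < R → ∃ χ : E2 → ℝ, ContDiff ℝ 1 χ ∧ HasCompactSupport χ ∧
    (∀ x ∈ Metric.ball (0 : E2) R, χ x = 1) ∧ (∀ x, 0 ≤ χ x) ∧ (∀ x, χ x ≤ 1) ∧
    ∀ x, ‖fderiv ℝ χ x‖ ≤ c / R := by
  let φ : ContDiffBump (0 : E2) := ⟨1, 2, by norm_num, by norm_num⟩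
  have hφ : ContDiff ℝ 1 (φ : E2 → ℝ) := φ.contDiff
  obtain ⟨c, hc⟩ := (hφ.continuous_fderiv (by norm_num)).bounded_above_of_compact_support
    (φ.hasCompactSupport.fderiv (𝕜 := ℝ))
  refine ⟨c, (norm_nonneg _).trans (hc 0), fun R hR => ⟨fun x => φ (R⁻¹ • x), ?_, ?_, ?_, ?_, ?_, ?_⟩⟩
  · exact hφ.comp (contDiff_const_smul _)
  · exact φ.hasCompactSupport.comp_smul (inv_ne_zero hR.ne')
  · intro x hx
    apply φ.one_of_mem_closedBall
    simp only [mem_closedBall_zero_iff, norm_smul, norm_inv, Real.norm_eq_abs, abs_of_pos hR]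
    rw [mem_ball_zero_iff] at hx
    rw [inv_mul_le_iff₀ hR]
    change ‖x‖ ≤ R * 1
    linarith
  · exact fun x => φ.nonneg
  · exact fun x => φ.le_one
  · intro x
    rw [fderiv_comp_smul, norm_smul, norm_inv, Real.norm_eq_abs, abs_of_pos hR, div_eq_inv_mul]
    gcongr
    exact hc _

/-- Ladyzhenskaya's inequality in the plane, without compact support. -/
lemma ladyzhenskaya : ∃ C : ℝ, 0 ≤ C ∧ ∀ u : E2 → ℝ, ContDiff ℝ 1 u →
    Integrable (fun x : E2 => ‖gradient u x‖ ^ 2) → Integrable (fun x : E2 => (u x) ^ 2) →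
    Integrable (fun x : E2 => (u x) ^ 4) ∧
    ∫ x : E2, (u x) ^ 4 ≤ C * (∫ x : E2, (u x) ^ 2) * ∫ x : E2, ‖gradient u x‖ ^ 2 := by
  obtain ⟨c, hc, hcut⟩ := cutoff
  set K : NNReal := lintegralPowLePowLIntegralFDerivConst (volume : Measure E2) 2 with hK
  refine ⟨4 * K, by positivity, fun u hu h1 h2 => ?_⟩
  simp only [norm_grad] at h1 ⊢
  obtain ⟨hG, hGle⟩ := cs_grad u hu h1 h2
  set G := ∫ x : E2, |u x| * ‖fderiv ℝ u x‖ with hGdef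
  set M := ∫ x : E2, (u x) ^ 2 with hM
  have hM0 : 0 ≤ M := integral_nonneg fun x => by positivity
  have hG0 : 0 ≤ G := integral_nonneg fun x => by positivity
  have hcu : Continuous u := hu.continuous
  have bound : ∀ R : ℝ, 0 < R → ∫⁻ x in Metric.ball (0 : E2) R, ENNReal.ofReal ((u x) ^ 4) ≤
      ENNReal.ofReal (K * (2 * G + c / R * M) ^ 2) := by
    intro R hR
    obtain ⟨χ, hχ, hχc, hχ1, hχ0, hχle, hχd⟩ := hcut R hR
    have hw : ContDiff ℝ 1 (fun x => χ x * (u x) ^ 2) := hχ.mul (hu.pow 2)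
    have hwc : HasCompactSupport (fun x => χ x * (u x) ^ 2) := hχc.mul_right
    have S := lintegral_pow_le_pow_lintegral_fderiv (volume : Measure E2) hw hwc (p := 2)
      (by simpa using Real.HolderConjugate.two_two)
    have hder : ∀ x, ‖fderiv ℝ (fun x => χ x * (u x) ^ 2) x‖ ≤
        2 * (|u x| * ‖fderiv ℝ u x‖) + c / R * (u x) ^ 2 := by
      intro x
      have d1 : HasFDerivAt χ (fderiv ℝ χ x) x := (hχ.differentiable (by norm_num) x).hasFDerivAt
      have d2 : HasFDerivAt u (fderiv ℝ u x) x := (hu.differentiable (by norm_num) x).hasFDerivAt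
      have d3 : HasFDerivAt (fun x => χ x * (u x) ^ 2) _ x := d1.mul (d2.pow 2)
      rw [d3.fderiv]
      refine (norm_add_le _ _).trans ?_
      rw [norm_smul (χ x), norm_smul (2 • u x ^ (2 - 1)), norm_smul (u x ^ 2)]
      have e1 : ‖χ x‖ ≤ 1 := by rw [Real.norm_eq_abs, abs_of_nonneg (hχ0 x)]; exact hχle x
      have e2 : ‖(u x) ^ 2‖ = (u x) ^ 2 := by rw [Real.norm_eq_abs, abs_of_nonneg (by positivity)]
      have e3 : ‖2 • u x ^ (2 - 1)‖ = 2 * |u x| := by simp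
      rw [e2, e3]
      have f1 : ‖χ x‖ * (2 * |u x| * ‖fderiv ℝ u x‖) ≤ 1 * (2 * |u x| * ‖fderiv ℝ u x‖) := by gcongr
      have f2 : (u x) ^ 2 * ‖fderiv ℝ χ x‖ ≤ (u x) ^ 2 * (c / R) := by gcongr; exact hχd x
      linarith
    have hDint : ∫⁻ x, ‖fderiv ℝ (fun x => χ x * (u x) ^ 2) x‖ₑ ≤ ENNReal.ofReal (2 * G + c / R * M) := by
      calc _ ≤ ∫⁻ x, ENNReal.ofReal (2 * (|u x| * ‖fderiv ℝ u x‖) + c / R * (u x) ^ 2) := by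
            apply lintegral_mono
            intro x
            simp only
            rw [← ofReal_norm]
            exact ENNReal.ofReal_le_ofReal (hder x)
        _ = ENNReal.ofReal (∫ x, (2 * (|u x| * ‖fderiv ℝ u x‖) + c / R * (u x) ^ 2)) := by
            rw [ofReal_integral_eq_lintegral_ofReal]
            · exact (hG.const_mul 2).add (h2.const_mul _)
            · exact Eventually.of_forall fun x => by positivity
        _ = _ := by
            rw [integral_add (hG.const_mul 2) (h2.const_mul _), integral_const_mul, integral_const_mul]
    calc ∫⁻ x in Metric.ball (0 : E2) R, ENNReal.ofReal ((u x) ^ 4)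
        = ∫⁻ x in Metric.ball (0 : E2) R, ‖χ x * (u x) ^ 2‖ₑ ^ (2 : ℝ) := by
          apply setLIntegral_congr_fun measurableSet_ball
          intro x hx
          simp only
          rw [hχ1 x hx, one_mul, ← ofReal_norm, ENNReal.rpow_two,
            ← ENNReal.ofReal_pow (norm_nonneg _), Real.norm_eq_abs, sq_abs]
          ring_nf
      _ ≤ ∫⁻ x, ‖χ x * (u x) ^ 2‖ₑ ^ (2 : ℝ) := setLIntegral_le_lintegral _ _
      _ ≤ K * (ENNReal.ofReal (2 * G + c / R * M)) ^ (2 : ℝ) := by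
          refine S.trans ?_
          gcongr
      _ = _ := by
          rw [ENNReal.rpow_two, ← ENNReal.ofReal_pow (by positivity), ENNReal.ofReal_mul (by positivity),
            ENNReal.ofReal_coe_nnreal]
  have hlim : ∫⁻ x : E2, ENNReal.ofReal ((u x) ^ 4) ≤ ENNReal.ofReal (K * (2 * G) ^ 2) := by
    have hcov : AECover (volume : Measure E2) atTop (fun n : ℝ => Metric.ball (0 : E2) n) :=
      aecover_ball tendsto_id
    have t1 := hcov.lintegral_tendsto_of_countably_generated
      (f := fun x => ENNReal.ofReal ((u x) ^ 4)) (by fun_prop)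
    have t2 : Tendsto (fun R : ℝ => ENNReal.ofReal (K * (2 * G + c / R * M) ^ 2)) atTop
        (nhds (ENNReal.ofReal (K * (2 * G) ^ 2))) := by
      apply ENNReal.tendsto_ofReal
      have : Tendsto (fun R : ℝ => (K : ℝ) * (2 * G + c / R * M) ^ 2) atTop
          (nhds (K * (2 * G + 0 * M) ^ 2)) := by
        have h0 : Tendsto (fun R : ℝ => c / R) atTop (nhds 0) := tendsto_id.const_div_atTop c
        exact ((((h0.mul_const M).const_add (2 * G)).pow 2).const_mul _)
      simpa using this
    refine le_of_tendsto_of_tendsto t1 t2 ?_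
    filter_upwards [eventually_gt_atTop 0] with R hR using bound R hR
  have hI : Integrable (fun x : E2 => (u x) ^ 4) := by
    refine ⟨by fun_prop, ?_⟩
    rw [hasFiniteIntegral_iff_ofReal (Eventually.of_forall fun x => by positivity)]
    exact hlim.trans_lt ENNReal.ofReal_lt_top
  refine ⟨hI, ?_⟩
  rw [← ofReal_integral_eq_lintegral_ofReal hI (Eventually.of_forall fun x => by positivity),
    ENNReal.ofReal_le_ofReal_iff (by positivity)] at hlim
  calc _ ≤ (K : ℝ) * (2 * G) ^ 2 := hlim
    _ = 4 * K * G ^ 2 := by ring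
    _ ≤ 4 * K * (M * ∫ x : E2, ‖fderiv ℝ u x‖ ^ 2) := by gcongr
    _ = _ := by ring

/-- Interpolation bound for the `L^p` term, `2 < p ≤ 3`. -/
lemma lp_bound (p C₀ : ℝ) (hp : 2 < p) (hp3 : p ≤ 3) (hC₀ : 0 ≤ C₀) (u : E2 → ℝ) (A M : ℝ) (hA : 0 ≤ A)
    (hM : M = ∫ x : E2, (u x) ^ 2)
    (h2 : Integrable (fun x : E2 => (u x) ^ 2)) (h4 : Integrable (fun x : E2 => (u x) ^ 4))
    (hp' : Integrable (fun x : E2 => |u x| ^ p))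
    (h4le : ∫ x : E2, (u x) ^ 4 ≤ C₀ * M * A) :
    ∫ x : E2, |u x| ^ p ≤ (1 + C₀) * M * (A + 1) ^ ((p - 2) / 2) := by
  set B := A + 1 with hB
  have hB0 : 0 < B := by linarith
  have hM0 : 0 ≤ M := hM ▸ integral_nonneg fun x => by positivity
  have pt : ∀ x, |u x| ^ p ≤ B ^ ((p - 2) / 2) * (u x) ^ 2 + B ^ ((p - 4) / 2) * (u x) ^ 4 := by
    intro x
    have hsq : ∀ r : ℝ, (Real.sqrt B) ^ r = B ^ (r / 2) := by
      intro r
      rw [Real.sqrt_eq_rpow, ← Real.rpow_mul hB0.le]; ring_nf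
    have e2 : (u x) ^ 2 = |u x| ^ (2 : ℝ) := by rw [Real.rpow_two, sq_abs]
    have e4 : (u x) ^ 4 = |u x| ^ (4 : ℝ) := by
      have : (4 : ℝ) = ((4 : ℕ) : ℝ) := by norm_num
      rw [this, Real.rpow_natCast, Even.pow_abs (by decide)]
    rcases eq_or_lt_of_le (abs_nonneg (u x)) with h0 | h0
    · rw [← h0, Real.zero_rpow (by linarith)]; positivity
    rcases le_total |u x| (Real.sqrt B) with h | h
    · have : |u x| ^ p ≤ B ^ ((p - 2) / 2) * (u x) ^ 2 := by
        rw [e2, ← hsq]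
        calc |u x| ^ p = |u x| ^ (p - 2) * |u x| ^ (2 : ℝ) := by rw [← Real.rpow_add h0]; ring_nf
          _ ≤ _ := by gcongr
      have : 0 ≤ B ^ ((p - 4) / 2) * (u x) ^ 4 := by positivity
      linarith
    · have : |u x| ^ p ≤ B ^ ((p - 4) / 2) * (u x) ^ 4 := by
        rw [e4, ← hsq]
        calc |u x| ^ p = |u x| ^ (p - 4) * |u x| ^ (4 : ℝ) := by rw [← Real.rpow_add h0]; ring_nf
          _ ≤ _ := by
            refine mul_le_mul_of_nonneg_right ?_ (by positivity)
            exact Real.rpow_le_rpow_of_nonpos (Real.sqrt_pos.2 hB0) h (by linarith)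
      have : 0 ≤ B ^ ((p - 2) / 2) * (u x) ^ 2 := by positivity
      linarith
  calc _ ≤ ∫ x : E2, (B ^ ((p - 2) / 2) * (u x) ^ 2 + B ^ ((p - 4) / 2) * (u x) ^ 4) :=
        integral_mono hp' ((h2.const_mul _).add (h4.const_mul _)) pt
    _ = B ^ ((p - 2) / 2) * M + B ^ ((p - 4) / 2) * ∫ x : E2, (u x) ^ 4 := by
        rw [integral_add (h2.const_mul _) (h4.const_mul _), integral_const_mul, integral_const_mul, hM]
    _ ≤ B ^ ((p - 2) / 2) * M + B ^ ((p - 4) / 2) * (C₀ * M * B) := by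
        gcongr
        exact h4le.trans (by gcongr; linarith)
    _ = _ := by
        have : B ^ ((p - 2) / 2) = B ^ ((p - 4) / 2) * B := by
          rw [← Real.rpow_add_one hB0.ne']; ring_nf
        rw [this]; ring

/-- The negative part of the logarithm. -/
noncomputable def lm (r : ℝ) : ℝ := max (-Real.log r) 0

lemma lm_nonneg (r : ℝ) : 0 ≤ lm r := le_max_right _ _

lemma lm_meas : Measurable lm := by
  unfold lm
  exact Real.measurable_log.neg.max measurable_const

lemma lm_int : Integrable (fun x : E2 => lm ‖x‖ ^ 2) := by
  rw [integrable_fun_norm_addHaar (volume : Measure E2) (f := fun r => lm r ^ 2)]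
  have hb : IntegrableOn (Set.indicator (Set.Ioc (0 : ℝ) 1) (fun _ => (4 : ℝ))) (Set.Ioi 0) := by
    apply Integrable.integrableOn
    rw [integrable_indicator_iff measurableSet_Ioc]
    exact integrableOn_const (by simp)
  refine Integrable.mono' hb ?_ ?_
  · have := lm_meas
    exact (Measurable.aestronglyMeasurable (by fun_prop))
  · rw [ae_restrict_iff' measurableSet_Ioi]
    refine Eventually.of_forall fun r hr => ?_
    have hr0 : 0 < r := hr
    simp only [finrank_euclideanSpace, Fintype.card_fin, Nat.reduceSub, pow_one, smul_eq_mul]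
    rw [Real.norm_eq_abs, abs_of_nonneg (by positivity)]
    by_cases h1 : r ≤ 1
    · rw [Set.indicator_of_mem (show r ∈ Set.Ioc (0:ℝ) 1 from ⟨hr0, h1⟩)]
      have hl : lm r = -Real.log r := max_eq_left (by have := Real.log_nonpos hr0.le h1; linarith)
      have h := Real.abs_log_mul_self_rpow_lt r (1 / 2) hr0 h1 (by norm_num)
      rw [← Real.sqrt_eq_rpow] at h
      have h' : (Real.log r * √r) ^ 2 ≤ 2 ^ 2 := by
        rw [← sq_abs]
        have h2 : |Real.log r * √r| ≤ 2 := by linarith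
        gcongr
      rw [mul_pow, Real.sq_sqrt hr0.le] at h'
      rw [hl]
      nlinarith
    · have : lm r = 0 := max_eq_right (by have := Real.log_nonneg (not_le.1 h1).le; linarith)
      rw [this]
      simp [h1]

lemma log_bound (C₀ : ℝ) (hC₀ : 0 ≤ C₀) (u : E2 → ℝ) (A M : ℝ) (hA : 0 ≤ A)
    (hM : M = ∫ x : E2, (u x) ^ 2)
    (h2 : Integrable (fun x : E2 => (u x) ^ 2)) (h4 : Integrable (fun x : E2 => (u x) ^ 4))
    (hl : Integrable (fun z : E2 × E2 => Real.log ‖z.1 - z.2‖ * (u z.1) ^ 2 * (u z.2) ^ 2))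
    (h4le : ∫ x : E2, (u x) ^ 4 ≤ C₀ * M * A) :
    -(∫ z : E2 × E2, Real.log ‖z.1 - z.2‖ * (u z.1) ^ 2 * (u z.2) ^ 2) ≤
      (1 / 2) * Real.log (A + 1) * M ^ 2 + M * ((∫ x : E2, lm ‖x‖ ^ 2) + C₀ * M) := by
  set B := A + 1 with hB
  have hB1 : 1 ≤ B := by linarith
  have hB0 : 0 < B := by linarith
  have hM0 : 0 ≤ M := hM ▸ integral_nonneg fun x => by positivity
  have hs : 0 < √B := Real.sqrt_pos.2 hB0
  set g : E2 → ℝ := fun x => B * lm ‖√B • x‖ ^ 2 with hg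
  have hgi : Integrable g := by
    refine Integrable.const_mul ?_ B
    exact lm_int.comp_smul hs.ne'
  have hgI : ∫ x, g x = ∫ x : E2, lm ‖x‖ ^ 2 := by
    rw [hg, integral_const_mul]
    rw [Measure.integral_comp_smul (volume : Measure E2) (fun x => lm ‖x‖ ^ 2) (√B)]
    simp only [finrank_euclideanSpace, Fintype.card_fin, Real.sq_sqrt hB0.le, smul_eq_mul]
    rw [abs_of_pos (by positivity), mul_inv_cancel_left₀ hB0.ne']
  have pt : ∀ z : E2 × E2, -(Real.log ‖z.1 - z.2‖ * (u z.1) ^ 2 * (u z.2) ^ 2) ≤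
      ((1 / 2) * Real.log B) * ((u z.1) ^ 2 * (u z.2) ^ 2) + (u z.2) ^ 2 * g (z.1 - z.2)
        + B⁻¹ * ((u z.1) ^ 4 * (u z.2) ^ 2) := by
    intro z
    have hlog : -Real.log ‖z.1 - z.2‖ ≤ (1 / 2) * Real.log B + lm ‖√B • (z.1 - z.2)‖ := by
      have hlB : 0 ≤ Real.log B := Real.log_nonneg hB1
      by_cases h0 : z.1 - z.2 = 0
      · rw [h0]
        simp only [norm_zero, Real.log_zero, neg_zero]
        have := lm_nonneg ‖√B • (0 : E2)‖
        linarith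
      · have hn : 0 < ‖z.1 - z.2‖ := norm_pos_iff.2 h0
        have : -Real.log ‖√B • (z.1 - z.2)‖ ≤ lm ‖√B • (z.1 - z.2)‖ := le_max_left _ _
        refine le_trans (le_of_eq ?_) (add_le_add_right this _)
        rw [norm_smul, Real.norm_eq_abs, abs_of_pos hs, Real.log_mul hs.ne' hn.ne', Real.log_sqrt hB0.le]
        ring
    have hy := young_abs B (lm ‖√B • (z.1 - z.2)‖) ((u z.1) ^ 2) hB0
    have k1 := mul_le_mul_of_nonneg_right hlog (show 0 ≤ (u z.1) ^ 2 * (u z.2) ^ 2 by positivity)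
    have k2 := mul_le_mul_of_nonneg_right hy (show 0 ≤ (u z.2) ^ 2 by positivity)
    have k3 : ((u z.1) ^ 2) ^ 2 / B = B⁻¹ * (u z.1) ^ 4 := by rw [div_eq_inv_mul]; ring
    rw [k3] at k2
    simp only [hg]
    linarith
  have i1 : Integrable (fun z : E2 × E2 => (u z.1) ^ 2 * (u z.2) ^ 2) := h2.mul_prod h2
  have i3 : Integrable (fun z : E2 × E2 => (u z.1) ^ 4 * (u z.2) ^ 2) := h4.mul_prod h2
  have i2 : Integrable (fun z : E2 × E2 => (u z.2) ^ 2 * g (z.1 - z.2)) := by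
    have := h2.convolution_integrand (ContinuousLinearMap.mul ℝ ℝ) hgi
    exact this
  have v1 : ∫ z : E2 × E2, (u z.1) ^ 2 * (u z.2) ^ 2 = M ^ 2 := by
    have := integral_prod_mul (μ := (volume : Measure E2)) (ν := (volume : Measure E2))
      (fun x => (u x) ^ 2) (fun x => (u x) ^ 2)
    rw [hM, sq, ← this]; rfl
  have v3 : ∫ z : E2 × E2, (u z.1) ^ 4 * (u z.2) ^ 2 = (∫ x, (u x) ^ 4) * M := by
    have := integral_prod_mul (μ := (volume : Measure E2)) (ν := (volume : Measure E2))
      (fun x => (u x) ^ 4) (fun x => (u x) ^ 2)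
    rw [hM, ← this]; rfl
  have v2 : ∫ z : E2 × E2, (u z.2) ^ 2 * g (z.1 - z.2) = M * ∫ x : E2, lm ‖x‖ ^ 2 := by
    have := integral_prod_symm (μ := (volume : Measure E2)) (ν := (volume : Measure E2)) _ i2
    refine this.trans ?_
    simp only [integral_const_mul, integral_sub_right_eq_self, integral_mul_const]
    rw [hgI, hM]
  rw [← integral_neg]
  calc _ ≤ ∫ z : E2 × E2, (((1 / 2) * Real.log B) * ((u z.1) ^ 2 * (u z.2) ^ 2)
        + (u z.2) ^ 2 * g (z.1 - z.2) + B⁻¹ * ((u z.1) ^ 4 * (u z.2) ^ 2)) :=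
        integral_mono hl.neg (((i1.const_mul _).add i2).add (i3.const_mul _)) pt
    _ = ((1 / 2) * Real.log B) * M ^ 2 + M * (∫ x : E2, lm ‖x‖ ^ 2) + B⁻¹ * ((∫ x, (u x) ^ 4) * M) := by
        have i12 : Integrable (fun z : E2 × E2 => ((1 / 2) * Real.log B) * ((u z.1) ^ 2 * (u z.2) ^ 2)
            + (u z.2) ^ 2 * g (z.1 - z.2)) := (i1.const_mul _).add i2
        rw [integral_add i12 (i3.const_mul _), integral_add (i1.const_mul _) i2,
          integral_const_mul, integral_const_mul, v1, v2, v3]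
    _ ≤ ((1 / 2) * Real.log B) * M ^ 2 + M * (∫ x : E2, lm ‖x‖ ^ 2) + B⁻¹ * ((C₀ * M * B) * M) := by
        gcongr
        exact h4le.trans (by gcongr; linarith)
    _ = _ := by field_simp; ring

/-- Lemma 4.3: sequences with `I(uₙ) → d` and `J(uₙ) → 0` are bounded in `H¹(ℝ²)`. -/
theorem stmt1 (b p : ℝ) (hb : 0 ≤ b) (hp : 2 < p)
    (V : E2 → ℝ) (hV : ContDiff ℝ 1 V)
    (V₀ V_inf : ℝ) (hV₀ : 0 < V₀) (hV₀inf : V₀ ≤ V_inf)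
    (hVbd : ∀ x, V₀ ≤ V x ∧ V x ≤ V_inf)
    (η : ℝ) (hη : 0 < η) (hVgrad : ∀ x, |⟪gradient V x, x⟫_ℝ| ≤ η)
    (d : ℝ) (u : ℕ → E2 → ℝ) (hu : ∀ n, ContDiff ℝ 1 (u n))
    (hint1 : ∀ n, Integrable (fun x : E2 => ‖gradient (u n) x‖ ^ 2))
    (hint2 : ∀ n, Integrable (fun x : E2 => (u n x) ^ 2))
    (hint3 : ∀ n, Integrable (fun x : E2 => |u n x| ^ p))
    (hint4 : ∀ n, Integrable
      (fun z : E2 × E2 => |Real.log ‖z.1 - z.2‖| * (u n z.1) ^ 2 * (u n z.2) ^ 2))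
    (hI : Tendsto (fun n => energyI b p V (u n)) atTop (nhds d))
    (hJ : Tendsto (fun n => energyJ b p V (u n)) atTop (nhds 0)) :
    ∃ C > (0 : ℝ), ∀ n,
      (∫ x : E2, (‖gradient (u n) x‖ ^ 2 + (u n x) ^ 2)) ≤ C := by
  obtain ⟨K₁, hK₁⟩ := hI.bddAbove_range
  obtain ⟨K₂, hK₂⟩ := hJ.bddBelow_range
  obtain ⟨C₀, hC₀, hlady⟩ := ladyzhenskaya
  set K := max K₁ 0 + max (-K₂) 0 with hK
  have hq : 0 ≤ ∫ x : E2, lm ‖x‖ ^ 2 := integral_nonneg fun x => by positivity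
  obtain ⟨D, hD, hnum⟩ := numeric b p K η (∫ x : E2, lm ‖x‖ ^ 2) C₀ (1 + C₀) hb hp (by positivity) hη hq hC₀
    (by positivity)
  refine ⟨D, hD, fun n => ?_⟩
  have hc : Continuous (u n) := (hu n).continuous
  have hVc : Continuous V := hV.continuous
  have hgV : Continuous (gradient V) := by
    have : Continuous (fderiv ℝ V) := hV.continuous_fderiv (by norm_num)
    exact (InnerProductSpace.toDual ℝ E2).symm.continuous.comp this
  obtain ⟨h4, h4le⟩ := hlady (u n) (hu n) (hint1 n) (hint2 n)
  have hl : Integrable (fun z : E2 × E2 =>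
      Real.log ‖z.1 - z.2‖ * (u n z.1) ^ 2 * (u n z.2) ^ 2) := by
    refine (hint4 n).mono ?_ (Eventually.of_forall fun z => ?_)
    · have : Measurable (u n) := hc.measurable
      exact Measurable.aestronglyMeasurable (by fun_prop)
    · simp
  have hVu : Integrable (fun x : E2 => V x * (u n x) ^ 2) := by
    refine (hint2 n).bdd_mul (c := V_inf) (by fun_prop) (Eventually.of_forall fun x => ?_)
    rw [Real.norm_eq_abs, abs_of_nonneg (hV₀.le.trans (hVbd x).1)]
    exact (hVbd x).2
  have hWu : Integrable (fun x : E2 => ⟪gradient V x, x⟫_ℝ * (u n x) ^ 2) := by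
    refine (hint2 n).bdd_mul (c := η) ?_ (Eventually.of_forall fun x => ?_)
    · exact (hgV.inner continuous_id).aestronglyMeasurable
    · exact hVgrad x
  rw [integral_add (hint1 n) (hint2 n)]
  have hA0 : 0 ≤ ∫ x : E2, ‖gradient (u n) x‖ ^ 2 := integral_nonneg fun x => by positivity
  refine hnum _ _ (∫ x : E2, |u n x| ^ p)
    (∫ z : E2 × E2, Real.log ‖z.1 - z.2‖ * (u n z.1) ^ 2 * (u n z.2) ^ 2)
    (∫ x : E2, V x * (u n x) ^ 2) (∫ x : E2, ⟪gradient V x, x⟫_ℝ * (u n x) ^ 2)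
    (energyI b p V (u n)) (energyJ b p V (u n)) hA0 (integral_nonneg fun x => by positivity)
    (integral_nonneg fun x => by positivity)
    (integral_nonneg fun x => mul_nonneg (hV₀.le.trans (hVbd x).1) (by positivity)) ?_ ?_ ?_ ?_ ?_ ?_ ?_
  · rw [← integral_const_mul]
    refine (norm_integral_le_integral_norm (μ := (volume : Measure E2))
      (f := fun x : E2 => ⟪gradient V x, x⟫_ℝ * (u n x) ^ 2)).trans ?_
    refine integral_mono hWu.norm ((hint2 n).const_mul η) fun x => ?_
    simp only [norm_mul, Real.norm_eq_abs]
    rw [abs_of_nonneg (show 0 ≤ (u n x) ^ 2 by positivity)]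
    exact mul_le_mul_of_nonneg_right (hVgrad x) (by positivity)
  · have := hK₁ ⟨n, rfl⟩
    have h1 := le_max_left K₁ 0
    have h2 := le_max_right (-K₂) 0
    simp only at this
    linarith
  · have := hK₂ ⟨n, rfl⟩
    have h1 := le_max_right K₁ 0
    have h2 := le_max_left (-K₂) 0
    simp only at this
    linarith
  · rw [energyI, integral_add (hint1 n) hVu]
  · rw [energyJ]
    congr 2
    have e : ∀ x : E2, 2 * ‖gradient (u n) x‖ ^ 2 +
      (V x - (1 / 2) * ⟪gradient V x, x⟫_ℝ) * (u n x) ^ 2 -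
      (2 * b * (p - 1) / p) * |u n x| ^ p = 2 * ‖gradient (u n) x‖ ^ 2 + V x * (u n x) ^ 2 -
      (1 / 2) * (⟪gradient V x, x⟫_ℝ * (u n x) ^ 2) - (2 * b * (p - 1) / p) * |u n x| ^ p := by
      intro x; ring
    simp_rw [e]
    have j1 := (hint1 n).const_mul 2
    have j2 := hWu.const_mul (1 / 2)
    have j3 := (hint3 n).const_mul (2 * b * (p - 1) / p)
    have j12 : Integrable (fun x : E2 => 2 * ‖gradient (u n) x‖ ^ 2 + V x * (u n x) ^ 2) := j1.add hVu
    have j123 : Integrable (fun x : E2 => 2 * ‖gradient (u n) x‖ ^ 2 + V x * (u n x) ^ 2 -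
      (1 / 2) * (⟪gradient V x, x⟫_ℝ * (u n x) ^ 2)) := j12.sub j2
    rw [integral_sub j123 j3, integral_sub j12 j2, integral_add j1 hVu,
      integral_const_mul, integral_const_mul, integral_const_mul]
  · exact log_bound C₀ hC₀ (u n) _ _ hA0 rfl (hint2 n) h4 hl h4le
  · intro hp3
    exact lp_bound p C₀ hp hp3 hC₀ (u n) _ _ hA0 rfl (hint2 n) h4 (hint3 n) h4le
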